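/- Let (X,d) be a compact metric space and f: X → X a continuous map satisfying the specification property, let φ: X → ℝ be continuous and α ∈ ℝ with K_α ≠ ∅, and assume mdim_M(X,f,d) < ∞. Then mdim_M(K_α, f, d) ≤ Λ_φ mdim_M(f, α, d). -/

import Mathlib

open Filter Set MeasureTheory
open scoped ENNReal NNReal Topology

noncomputable section

variable {Y : Type*}

/-- The dynamical (Bowen) distance `d_n` associated to a distance function `d`. -/
def dynDist (d : Y → Y → ℝ) (f : Y → Y) (n : ℕ) (x y : Y) : ℝ :=
  ⨆ j : Fin n, d (f^[(j : ℕ)] x) (f^[(j : ℕ)] y)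

/-- The `(n,ε)`-dynamical ball around `x`. -/
def dynBall (d : Y → Y → ℝ) (f : Y → Y) (n : ℕ) (ε : ℝ) (x : Y) : Set Y :=
  {y | dynDist d f n x y < ε}

/-- A set `E` is `(n,ε)`-separated if distinct points of `E` are at `d_n`-distance `> ε`. -/
def IsDynSep (d : Y → Y → ℝ) (f : Y → Y) (n : ℕ) (ε : ℝ) (E : Set Y) : Prop :=
  E.Pairwise fun x y => ε < dynDist d f n x y

/-- Maximal cardinality of an `(n,ε)`-separated subset of `P`. -/
def sepMaxCard (d : Y → Y → ℝ) (f : Y → Y) (n : ℕ) (ε : ℝ) (P : Set Y) : ℕ :=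
  sSup {m | ∃ E : Finset Y, ↑E ⊆ P ∧ IsDynSep d f n ε ↑E ∧ E.card = m}

/-- `h(f,ε) = limsup_n (1/n) log s(f,n,ε)` (computed inside `P`). -/
def hSep (d : Y → Y → ℝ) (f : Y → Y) (P : Set Y) (ε : ℝ) : EReal :=
  Filter.limsup (fun n : ℕ => ((Real.log (sepMaxCard d f n ε P) / n : ℝ) : EReal)) Filter.atTop

/-- Upper metric mean dimension (separated-sets version). -/
def mdimSep (d : Y → Y → ℝ) (f : Y → Y) (P : Set Y) : EReal :=
  Filter.limsup (fun ε : ℝ => hSep d f P ε * (((|Real.log ε|)⁻¹ : ℝ) : EReal))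
    (nhdsWithin (0 : ℝ) (Set.Ioi 0))

/-- The Carathéodory sum `m(Z,s,N,ε)`: infimum over countable covers of `Z` by dynamical
balls of lengths `≥ N` of `Σ exp(−s·n_i)`. -/
def mCover (d : Y → Y → ℝ) (f : Y → Y) (Z : Set Y) (s : ℝ) (N : ℕ) (ε : ℝ) : ℝ≥0∞ :=
  ⨅ (Γ : Set (Y × ℕ)) (_ : Γ.Countable) (_ : ∀ q ∈ Γ, N ≤ q.2)
    (_ : Z ⊆ ⋃ q ∈ Γ, dynBall d f q.2 ε q.1),
      ∑' q : Γ, ENNReal.ofReal (Real.exp (-(s * ((q : Y × ℕ).2 : ℝ))))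

/-- `m(Z,s,ε) = lim_{N→∞} m(Z,s,N,ε)` (a monotone limit, hence a supremum). -/
def mCarat (d : Y → Y → ℝ) (f : Y → Y) (Z : Set Y) (s : ℝ) (ε : ℝ) : ℝ≥0∞ :=
  ⨆ N : ℕ, mCover d f Z s N ε

/-- `h(Z,f,ε) = inf {s : m(Z,s,ε) = 0}`. -/
def hCov (d : Y → Y → ℝ) (f : Y → Y) (Z : Set Y) (ε : ℝ) : ℝ :=
  sInf {s : ℝ | mCarat d f Z s ε = 0}

/-- Upper metric mean dimension of `f` on the (possibly non-compact) subset `Z`. -/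
def mdimC (d : Y → Y → ℝ) (f : Y → Y) (Z : Set Y) : EReal :=
  Filter.limsup (fun ε : ℝ => ((hCov d f Z ε * (|Real.log ε|)⁻¹ : ℝ) : EReal))
    (nhdsWithin (0 : ℝ) (Set.Ioi 0))

/-- Birkhoff average `(1/n) Σ_{j<n} φ(f^j x)`. -/
def birkhoff (f : Y → Y) (φ : Y → ℝ) (n : ℕ) (x : Y) : ℝ :=
  (∑ j ∈ Finset.range n, φ (f^[j] x)) / n

/-- The level set `K_α`. -/
def Kset (f : Y → Y) (φ : Y → ℝ) (α : ℝ) : Set Y :=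
  {x | Filter.Tendsto (fun n : ℕ => birkhoff f φ n x) Filter.atTop (nhds α)}

/-- The set `P(α,δ,n)`. -/
def Pset (f : Y → Y) (φ : Y → ℝ) (α δ : ℝ) (n : ℕ) : Set Y :=
  {x | |birkhoff f φ n x - α| < δ}

/-- Minimal number of `(n,ε)`-dynamical balls needed to cover `P`. -/
def coverMinCard (d : Y → Y → ℝ) (f : Y → Y) (n : ℕ) (ε : ℝ) (P : Set Y) : ℕ :=
  sInf {m | ∃ F : Finset Y, F.card = m ∧ P ⊆ ⋃ x ∈ F, dynBall d f n ε x}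

/-- `Λ_φ(α,ε) = lim_{δ→0} liminf_n (1/n) log N(α,δ,n,ε)` (a monotone limit, hence an
infimum over `δ > 0`). -/
def LambdaEps (d : Y → Y → ℝ) (f : Y → Y) (φ : Y → ℝ) (α ε : ℝ) : EReal :=
  ⨅ (δ : ℝ) (_ : 0 < δ),
    Filter.liminf (fun n : ℕ =>
      ((Real.log (coverMinCard d f n ε (Pset f φ α δ n)) / n : ℝ) : EReal)) Filter.atTop

/-- `Λ_φ mdim_M(f,α,d) = limsup_{ε→0} Λ_φ(α,ε)/|log ε|`. -/
def LambdaMdim (d : Y → Y → ℝ) (f : Y → Y) (φ : Y → ℝ) (α : ℝ) : EReal :=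
  Filter.limsup (fun ε : ℝ => LambdaEps d f φ α ε * (((|Real.log ε|)⁻¹ : ℝ) : EReal))
    (nhdsWithin (0 : ℝ) (Set.Ioi 0))

/-- A finite Borel partition of `X`. -/
structure FinBorelPartition (X : Type*) [MeasurableSpace X] where
  parts : Finset (Set X)
  meas : ∀ s ∈ parts, MeasurableSet s
  cover : ∀ x : X, ∃ s ∈ parts, x ∈ s
  disj : ∀ s ∈ parts, ∀ t ∈ parts, s ≠ t → Disjoint s t

/-- The dynamical refinement `ξ^n = ⋁_{j=0}^{n−1} f^{−j} ξ` of a finite family of sets. -/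
def dynRefine {X : Type*} (f : X → X) (P : Finset (Set X)) (n : ℕ) : Finset (Set X) :=
  letI := Classical.decEq (Set X)
  ((Finset.range n).pi fun _ => P).image fun c =>
    ⋂ (j : ℕ) (h : j ∈ Finset.range n), f^[j] ⁻¹' c j h

/-- Entropy `H_μ(P) = Σ_C −μ(C) log μ(C)` of a finite family of sets. -/
def partEntropy {X : Type*} [MeasurableSpace X] (μ : Measure X) (P : Finset (Set X)) : ℝ :=
  ∑ s ∈ P, Real.negMulLog (μ s).toReal

/-- `h_μ(f,ξ) = lim_n (1/n) H_μ(ξ^n)`. -/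
def dynEntropy {X : Type*} [MeasurableSpace X] (f : X → X) (μ : Measure X)
    (ξ : FinBorelPartition X) : ℝ :=
  Filter.limsup (fun n : ℕ => partEntropy μ (dynRefine f ξ.parts n) / n) Filter.atTop

/-- `H_φ mdim_M(f,α,d)`. -/
def HphiMdim {X : Type*} [MetricSpace X] [MeasurableSpace X] (f : X → X) (φ : X → ℝ)
    (α : ℝ) : EReal :=
  Filter.limsup (fun ε : ℝ =>
    (⨆ (μ : ProbabilityMeasure X)
        (_ : Measure.map f (μ : Measure X) = (μ : Measure X) ∧
             ∫ x, φ x ∂(μ : Measure X) = α),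
      ⨅ (ξ : FinBorelPartition X) (_ : ∀ s ∈ ξ.parts, Metric.diam s < ε),
        ((dynEntropy f (μ : Measure X) ξ : ℝ) : EReal)) * (((|Real.log ε|)⁻¹ : ℝ) : EReal))
    (nhdsWithin (0 : ℝ) (Set.Ioi 0))

/-- The specification property. -/
def SpecificationProperty {X : Type*} [MetricSpace X] (f : X → X) : Prop :=
  ∀ ε : ℝ, 0 < ε → ∃ m : ℕ, ∀ (k : ℕ) (a b : Fin k → ℕ) (x : Fin k → X),
    (∀ j, a j ≤ b j) →
    (∀ (j : ℕ) (h : j + 1 < k), b ⟨j, Nat.lt_of_succ_lt h⟩ + m ≤ a ⟨j + 1, h⟩) →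
    ∃ y : X, ∀ (j : Fin k) (p : ℕ), p ≤ b j - a j →
      dist (f^[p + a j] y) (f^[p] (x j)) < ε


/-- The distance function of a metric space, as a plain function. -/
def mDist (X : Type*) [MetricSpace X] : X → X → ℝ := fun x y => dist x y

end

theorem dynBall_mem_nhds {X : Type*} [MetricSpace X] {f : X → X} (hf : Continuous f)
    (n : ℕ) {ε : ℝ} (hε : 0 < ε) (x : X) : dynBall (mDist X) f n ε x ∈ 𝓝 x := by
  have h : ∀ᶠ y in 𝓝 x, ∀ j : Fin n, dist (f^[(j : ℕ)] x) (f^[(j : ℕ)] y) < ε := by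
    refine eventually_all.2 fun j => ?_
    have hc : Continuous fun y => dist (f^[(j : ℕ)] x) (f^[(j : ℕ)] y) :=
      continuous_const.dist (hf.iterate j)
    exact hc.continuousAt.eventually_lt continuousAt_const (by simpa using hε)
  filter_upwards [h] with y hy
  change (⨆ j : Fin n, dist (f^[(j : ℕ)] x) (f^[(j : ℕ)] y)) < ε
  rcases isEmpty_or_nonempty (Fin n) with _ | _
  · simpa using hε
  · obtain ⟨i, hi⟩ := exists_eq_ciSup_of_finite
      (f := fun j : Fin n => dist (f^[(j : ℕ)] x) (f^[(j : ℕ)] y))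
    exact hi ▸ hy i

theorem exists_finset_card_eq_coverMinCard {X : Type*} [MetricSpace X] [CompactSpace X]
    {f : X → X} (hf : Continuous f) (n : ℕ) {ε : ℝ} (hε : 0 < ε) (P : Set X) :
    ∃ F : Finset X, F.card = coverMinCard (mDist X) f n ε P ∧
      P ⊆ ⋃ x ∈ F, dynBall (mDist X) f n ε x := by
  obtain ⟨t, ht⟩ := CompactSpace.elim_nhds_subcover (dynBall (mDist X) f n ε)
    (dynBall_mem_nhds hf n hε)
  exact Nat.sInf_mem (s := {m | ∃ F : Finset X, F.card = m ∧
    P ⊆ ⋃ x ∈ F, dynBall (mDist X) f n ε x}) ⟨t.card, t, rfl, ht ▸ subset_univ P⟩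

theorem Kset_subset_iUnion_Pset (f : Y → Y) (φ : Y → ℝ) (α : ℝ) {δ : ℝ} (hδ : 0 < δ) :
    Kset f φ α ⊆ ⋃ k : ℕ, ⋂ n ≥ k, Pset f φ α δ n := by
  intro x hx
  obtain ⟨k, hk⟩ := Metric.tendsto_atTop.1 hx δ hδ
  exact mem_iUnion.2 ⟨k, mem_iInter₂.2 fun n hn => by
    simpa [Pset, Real.dist_eq] using hk n hn⟩

/-- Countably many finite covers by dynamical balls of constant length bound the
Carathéodory sum. -/
theorem mCover_le_tsum (d : Y → Y → ℝ) (f : Y → Y) {Z : Set Y} (s : ℝ) {N : ℕ} {ε : ℝ}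
    (F : ℕ → Finset Y) (n : ℕ → ℕ) (hn : ∀ k, N ≤ n k)
    (hZ : Z ⊆ ⋃ k, ⋃ x ∈ F k, dynBall d f (n k) ε x) :
    mCover d f Z s N ε ≤
      ∑' k, ((F k).card : ℝ≥0∞) * ENNReal.ofReal (Real.exp (-(s * n k))) := by
  have hcount : (⋃ k, (↑(F k ×ˢ {n k}) : Set (Y × ℕ))).Countable :=
    countable_iUnion fun k => Finset.countable_toSet _
  have hlen : ∀ q ∈ ⋃ k, (↑(F k ×ˢ {n k}) : Set (Y × ℕ)), N ≤ q.2 := by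
    intro q hq
    obtain ⟨k, hk⟩ := mem_iUnion.1 hq
    rw [Finset.mem_coe, Finset.mem_product, Finset.mem_singleton] at hk
    exact hk.2 ▸ hn k
  have hcover : Z ⊆ ⋃ q ∈ ⋃ k, (↑(F k ×ˢ {n k}) : Set (Y × ℕ)), dynBall d f q.2 ε q.1 := by
    intro x hx
    obtain ⟨k, hk⟩ := mem_iUnion.1 (hZ hx)
    obtain ⟨y, hy, hxy⟩ := mem_iUnion₂.1 hk
    exact mem_iUnion₂.2 ⟨(y, n k), mem_iUnion.2 ⟨k, by simpa using hy⟩, hxy⟩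
  refine (iInf₂_le_of_le _ hcount (iInf₂_le_of_le hlen hcover le_rfl)).trans ?_
  refine (ENNReal.tsum_iUnion_le_tsum
    (fun q : Y × ℕ => ENNReal.ofReal (Real.exp (-(s * (q.2 : ℝ))))) _).trans ?_
  refine ENNReal.tsum_le_tsum fun k => le_of_eq ?_
  rw [Finset.tsum_subtype' (F k ×ˢ {n k})
    (fun q : Y × ℕ => ENNReal.ofReal (Real.exp (-(s * (q.2 : ℝ))))), Finset.sum_product]
  simp

theorem mCarat_Kset_eq_zero {X : Type*} [MetricSpace X] [CompactSpace X]
    {f : X → X} (hf : Continuous f) (φ : X → ℝ) (α : ℝ) {ε s : ℝ} (hε : 0 < ε)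
    (hs : LambdaEps (mDist X) f φ α ε < s) :
    mCarat (mDist X) f (Kset f φ α) s ε = 0 := by
  obtain ⟨δ, hδ⟩ := iInf_lt_iff.1 hs
  obtain ⟨hδ0, hlim⟩ := iInf_lt_iff.1 hδ
  obtain ⟨r, hlr, hrs⟩ := EReal.lt_iff_exists_real_btwn.1 hlim
  have hrs : r < s := EReal.coe_lt_coe_iff.1 hrs
  have hfreq := frequently_lt_of_liminf_lt (by isBoundedDefault) hlr
  have hdecay : Tendsto (fun n : ℕ => ENNReal.ofReal (Real.exp (-((s - r) * n)))) atTop (𝓝 0) := by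
    rw [← ENNReal.ofReal_zero]
    refine ENNReal.tendsto_ofReal (Real.tendsto_exp_neg_atTop_nhds_zero.comp ?_)
    exact tendsto_natCast_atTop_atTop.const_mul_atTop (sub_pos.2 hrs)
  refine iSup_eq_bot.2 fun N => le_bot_iff.1 (ENNReal.le_of_forall_pos_le_add ?_)
  intro η hη _
  obtain ⟨u, hu0, hu⟩ := ENNReal.exists_pos_sum_of_countable' (ENNReal.coe_pos.2 hη).ne' ℕ
  have hex : ∀ k : ℕ, ∃ n : ℕ, (N ≤ n ∧ k ≤ n) ∧
      ((coverMinCard (mDist X) f n ε (Pset f φ α δ n) : ℕ) : ℝ≥0∞) *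
        ENNReal.ofReal (Real.exp (-(s * n))) ≤ u k := by
    intro k
    obtain ⟨n, hlog, ⟨⟨hN, hk⟩, hpos⟩, hsmall⟩ := (hfreq.and_eventually
      (((eventually_ge_atTop N).and (eventually_ge_atTop k)).and
        (eventually_gt_atTop 0) |>.and (hdecay.eventually_lt_const (hu0 k)))).exists
    refine ⟨n, ⟨hN, hk⟩, le_trans ?_ hsmall.le⟩
    have hn : (0 : ℝ) < n := Nat.cast_pos.2 hpos
    have hlog' := (div_lt_iff₀ hn).1 (EReal.coe_lt_coe_iff.1 hlog)
    have hcard : (coverMinCard (mDist X) f n ε (Pset f φ α δ n) : ℝ) ≤ Real.exp (r * n) :=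
      (Real.le_exp_log _).trans (Real.exp_le_exp.2 hlog'.le)
    rw [← ENNReal.ofReal_natCast, ← ENNReal.ofReal_mul (Nat.cast_nonneg _)]
    refine ENNReal.ofReal_le_ofReal ((mul_le_mul_of_nonneg_right hcard (Real.exp_nonneg _)).trans ?_)
    rw [← Real.exp_add]
    exact Real.exp_le_exp.2 (by linarith)
  choose n hn hcost using hex
  choose F hFcard hF using fun k =>
    exists_finset_card_eq_coverMinCard hf (n k) hε (Pset f φ α δ (n k))
  calc mCover (mDist X) f (Kset f φ α) s N ε
      ≤ ∑' k, ((F k).card : ℝ≥0∞) * ENNReal.ofReal (Real.exp (-(s * n k))) := by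
        refine mCover_le_tsum _ _ s F n (fun k => (hn k).1) ?_
        refine (Kset_subset_iUnion_Pset f φ α hδ0).trans (iUnion_mono fun k => ?_)
        exact (iInter₂_subset (n k) (hn k).2).trans (hF k)
    _ ≤ ∑' k, u k := ENNReal.tsum_le_tsum fun k => by rw [hFcard]; exact hcost k
    _ ≤ ⊥ + η := by simpa using hu.le

theorem one_le_mCover_of_nonpos (d : Y → Y → ℝ) (f : Y → Y) {Z : Set Y} (hZ : Z.Nonempty)
    {s : ℝ} (hs : s ≤ 0) (N : ℕ) (ε : ℝ) : 1 ≤ mCover d f Z s N ε := by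
  refine le_iInf₂ fun Γ _ => le_iInf₂ fun _ hcover => ?_
  obtain ⟨x, hx⟩ := hZ
  obtain ⟨q, hq, -⟩ := mem_iUnion₂.1 (hcover hx)
  refine le_trans ?_ (ENNReal.le_tsum (⟨q, hq⟩ : Γ))
  rw [ENNReal.one_le_ofReal, Real.one_le_exp_iff, neg_nonneg]
  exact mul_nonpos_of_nonpos_of_nonneg hs (Nat.cast_nonneg _)

theorem bddBelow_setOf_mCarat_eq_zero (d : Y → Y → ℝ) (f : Y → Y) {Z : Set Y}
    (hZ : Z.Nonempty) (ε : ℝ) : BddBelow {s : ℝ | mCarat d f Z s ε = 0} := by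
  refine ⟨0, fun s hs => le_of_not_ge fun h => ?_⟩
  have h1 := (one_le_mCover_of_nonpos d f hZ h 0 ε).trans
    (le_iSup (fun N => mCover d f Z s N ε) 0)
  exact absurd (h1.trans_eq hs) (by simp)

theorem hCov_Kset_le_LambdaEps {X : Type*} [MetricSpace X] [CompactSpace X]
    {f : X → X} (hf : Continuous f) (φ : X → ℝ) {α : ℝ} (hK : (Kset f φ α).Nonempty)
    {ε : ℝ} (hε : 0 < ε) :
    (hCov (mDist X) f (Kset f φ α) ε : EReal) ≤ LambdaEps (mDist X) f φ α ε := by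
  refine le_of_not_gt fun hlt => ?_
  obtain ⟨s, hs, hsc⟩ := EReal.lt_iff_exists_real_btwn.1 hlt
  exact absurd (csInf_le (bddBelow_setOf_mCarat_eq_zero (mDist X) f hK ε)
    (mCarat_Kset_eq_zero hf φ α hε hs)) (not_le.2 (EReal.coe_lt_coe_iff.1 hsc))

/-- Proposition 3.1: `mdim_M(K_α,f,d) ≤ Λ_φ mdim_M(f,α,d)`. -/
theorem mdim_level_set_le_Lambda
    {X : Type*} [MetricSpace X] [CompactSpace X] [MeasurableSpace X] [BorelSpace X]
    (f : X → X) (hf : Continuous f) (hspec : SpecificationProperty f)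
    (φ : X → ℝ) (hφ : Continuous φ) (α : ℝ) (hK : (Kset f φ α).Nonempty)
    (hfin : mdimSep (mDist X) f Set.univ < ⊤) :
    mdimC (mDist X) f (Kset f φ α) ≤ LambdaMdim (mDist X) f φ α := by
  refine limsup_le_limsup ?_
  filter_upwards [self_mem_nhdsWithin] with ε hε
  rw [EReal.coe_mul]
  exact mul_le_mul_of_nonneg_right (hCov_Kset_le_LambdaEps hf φ hK hε)
    (EReal.coe_nonneg.2 (inv_nonneg.2 (abs_nonneg _)))
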